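/- The number of even involutions of length n that avoid the pattern 132 and contain the pattern 1234 exactly once equals fib(n−2) if n is a positive multiple of 4, and equals 0 otherwise, where fib is the Fibonacci sequence with fib(0)=0, fib(1)=1 and fib(n)=fib(n−1)+fib(n−2). (Equivalently, the generating function of this sequence is x⁴(x⁴+1)/((1+3x²+x⁴)(1−3x²+x⁴)).) -/

import Mathlib

open Finset

/-- The number of occurrences of the pattern `τ` (of length `k`) in the
permutation `π` (of length `n`): the number of strictly increasing index
sequences along which `π` is order-isomorphic to `τ`. -/
def occ {k n : ℕ} (τ : Equiv.Perm (Fin k)) (π : Equiv.Perm (Fin n)) : ℕ :=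
  (Finset.univ.filter (fun f : Fin k → Fin n =>
    (∀ a b : Fin k, a < b → f a < f b) ∧
    (∀ a b : Fin k, τ a < τ b ↔ π (f a) < π (f b)))).card

/-- The number of inversions of a permutation: pairs `i < j` with `π i > π j`. -/
def inversions {n : ℕ} (π : Equiv.Perm (Fin n)) : ℕ :=
  (Finset.univ.filter (fun p : Fin n × Fin n => p.1 < p.2 ∧ π p.2 < π p.1)).card

/-- The number of fixed points of a permutation. -/
def fixedPointCount {n : ℕ} (π : Equiv.Perm (Fin n)) : ℕ :=
  (Finset.univ.filter (fun j : Fin n => π j = j)).card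

/-- The pattern `132` as a permutation of `Fin 3` (zero-indexed values `0,2,1`). -/
def p132 : Equiv.Perm (Fin 3) := Equiv.swap 1 2

/-- Number of even involutions of length n avoiding 132 and containing 1234
exactly once. -/
def cnt (n : ℕ) : ℕ :=
  (Finset.univ.filter (fun π : Equiv.Perm (Fin n) =>
    (∀ i, π (π i) = i) ∧ Even (inversions π) ∧ occ p132 π = 0 ∧
      occ (1 : Equiv.Perm (Fin 4)) π = 1)).card


/-! ### Pattern predicates -/

def IsInvol {n : ℕ} (s : Equiv.Perm (Fin n)) : Prop := ∀ i, s (s i) = i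

/-- no `132` avoiding the index `p` -/
def Q3 {n : ℕ} (p : Fin n) (s : Equiv.Perm (Fin n)) : Prop :=
  ∀ i j k, i ≠ p → j ≠ p → k ≠ p → i < j → j < k → s i < s k → s k < s j → False

/-- no `1234` avoiding the index `p` -/
def Q4 {n : ℕ} (p : Fin n) (s : Equiv.Perm (Fin n)) : Prop :=
  ∀ i j k l, i ≠ p → j ≠ p → k ≠ p → l ≠ p → i < j → j < k → k < l →
    s i < s j → s j < s k → s k < s l → False

def N3 {n : ℕ} (s : Equiv.Perm (Fin n)) : Prop :=
  ∀ i j k, i < j → j < k → s i < s k → s k < s j → False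

def N4 {n : ℕ} (s : Equiv.Perm (Fin n)) : Prop :=
  ∀ i j k l, i < j → j < k → k < l → s i < s j → s j < s k → s k < s l → False

def fixS {n : ℕ} (s : Equiv.Perm (Fin n)) : Finset (Fin n) :=
  Finset.univ.filter (fun i => s i = i)

def opS {n : ℕ} (s : Equiv.Perm (Fin n)) : Finset (Fin n) :=
  Finset.univ.filter (fun i => i < s i)

lemma mem_fixS {n : ℕ} (s : Equiv.Perm (Fin n)) (i : Fin n) : i ∈ fixS s ↔ s i = i := by
  simp [fixS]

lemma mem_opS {n : ℕ} (s : Equiv.Perm (Fin n)) (i : Fin n) : i ∈ opS s ↔ i < s i := by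
  simp [opS]

open Classical in
/-- involutions avoiding `132` and `1234`, with `h` fixed points -/
noncomputable def T (n h : ℕ) : Finset (Equiv.Perm (Fin n)) :=
  Finset.univ.filter (fun s => IsInvol s ∧ N3 s ∧ N4 s ∧ (fixS s).card = h)

open Classical in
/-- as `T`, but ignoring the fixed point `p` in the pattern conditions -/
noncomputable def X {n : ℕ} (p : Fin n) (h : ℕ) : Finset (Equiv.Perm (Fin n)) :=
  Finset.univ.filter (fun s => IsInvol s ∧ s p = p ∧ Q3 p s ∧ Q4 p s ∧ (fixS s).card = h)

/-! ### Inserting a fixed point -/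

def ins {n : ℕ} (p : Fin (n + 1)) (s : Equiv.Perm (Fin n)) : Equiv.Perm (Fin (n + 1)) :=
  (finSuccEquiv' p).symm.permCongr (Equiv.optionCongr s)

lemma ins_self {n : ℕ} (p : Fin (n + 1)) (s : Equiv.Perm (Fin n)) : ins p s p = p := by
  simp [ins, Equiv.permCongr_apply]

lemma ins_succAbove {n : ℕ} (p : Fin (n + 1)) (s : Equiv.Perm (Fin n)) (i : Fin n) :
    ins p s (p.succAbove i) = p.succAbove (s i) := by
  simp [ins, Equiv.permCongr_apply]

lemma ins_injective {n : ℕ} (p : Fin (n + 1)) : Function.Injective (ins p) := by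
  intro s t h
  ext i
  have := congrArg (fun u => u (p.succAbove i)) h
  simp only [ins_succAbove] at this
  rw [Fin.succAbove_right_injective this]

lemma ins_surj {n : ℕ} (p : Fin (n + 1)) (t : Equiv.Perm (Fin (n + 1))) (ht : t p = p) :
    ∃ s, ins p s = t := by
  have key : ∀ (u : Equiv.Perm (Fin (n+1))), u p = p → ∀ i, ∃ j, p.succAbove j = u (p.succAbove i) := by
    intro u hu i
    apply Fin.exists_succAbove_eq
    intro h
    rw [← hu] at h
    exact Fin.succAbove_ne p i (u.injective (by simpa [hu] using h))
  choose f hf using key t ht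
  have ht' : t.symm p = p := by rw [Equiv.symm_apply_eq, ht]
  choose g hg using key t.symm ht'
  refine ⟨⟨f, g, ?_, ?_⟩, ?_⟩
  · intro i
    apply Fin.succAbove_right_injective (p := p)
    rw [hg, hf]; simp
  · intro i
    apply Fin.succAbove_right_injective (p := p)
    rw [hf, hg]; simp
  · refine Equiv.ext (fun x => ?_)
    rcases Fin.eq_self_or_eq_succAbove p x with rfl | ⟨i, rfl⟩
    · rw [ins_self, ht]
    · rw [ins_succAbove]; exact hf i

lemma ins_inv {n : ℕ} (p : Fin (n + 1)) (s : Equiv.Perm (Fin n)) : IsInvol (ins p s) ↔ IsInvol s := by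
  constructor
  · intro h i
    have := h (p.succAbove i)
    rw [ins_succAbove, ins_succAbove] at this
    exact Fin.succAbove_right_injective this
  · intro h x
    rcases Fin.eq_self_or_eq_succAbove p x with rfl | ⟨i, rfl⟩
    · rw [ins_self, ins_self]
    · rw [ins_succAbove, ins_succAbove, h]

lemma ins_Q3 {n : ℕ} (p : Fin (n + 1)) (s : Equiv.Perm (Fin n)) : Q3 p (ins p s) ↔ N3 s := by
  constructor
  · intro h i j k h1 h2 h3 h4
    apply h (p.succAbove i) (p.succAbove j) (p.succAbove k) <;>
      simp [ins_succAbove, Fin.succAbove_ne, *]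
  · intro h x y z hx hy hz
    obtain ⟨i, rfl⟩ := Fin.exists_succAbove_eq hx
    obtain ⟨j, rfl⟩ := Fin.exists_succAbove_eq hy
    obtain ⟨k, rfl⟩ := Fin.exists_succAbove_eq hz
    simpa [ins_succAbove] using h i j k

lemma ins_Q4 {n : ℕ} (p : Fin (n + 1)) (s : Equiv.Perm (Fin n)) : Q4 p (ins p s) ↔ N4 s := by
  constructor
  · intro h i j k l h1 h2 h3 h4 h5 h6
    apply h (p.succAbove i) (p.succAbove j) (p.succAbove k) (p.succAbove l) <;>
      simp [ins_succAbove, Fin.succAbove_ne, *]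
  · intro h x y z w hx hy hz hw
    obtain ⟨i, rfl⟩ := Fin.exists_succAbove_eq hx
    obtain ⟨j, rfl⟩ := Fin.exists_succAbove_eq hy
    obtain ⟨k, rfl⟩ := Fin.exists_succAbove_eq hz
    obtain ⟨l, rfl⟩ := Fin.exists_succAbove_eq hw
    simpa [ins_succAbove] using h i j k l

lemma ins_fix {n : ℕ} (p : Fin (n + 1)) (s : Equiv.Perm (Fin n)) :
    (fixS (ins p s)).card = (fixS s).card + 1 := by
  have : fixS (ins p s) = insert p ((fixS s).map p.succAboveEmb) := by
    ext x
    rcases Fin.eq_self_or_eq_succAbove p x with rfl | ⟨i, rfl⟩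
    · simp [mem_fixS, ins_self]
    · simp [mem_fixS, ins_succAbove, Fin.succAbove_ne]
  rw [this, Finset.card_insert_of_notMem, Finset.card_map]
  simp [Fin.succAbove_ne]

lemma card_X {n : ℕ} (p : Fin (n + 1)) (h : ℕ) : (X p (h + 1)).card = (T n h).card := by
  symm
  apply Finset.card_bij (fun s _ => ins p s)
  · intro s hs
    simp only [T, Finset.mem_filter, Finset.mem_univ, true_and] at hs
    simp only [X, Finset.mem_filter, Finset.mem_univ, true_and, ins_inv, ins_Q3, ins_Q4, ins_fix,
      ins_self]
    tauto
  · intro s _ t _ h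
    exact ins_injective p h
  · intro t ht
    simp only [X, Finset.mem_filter, Finset.mem_univ, true_and] at ht
    obtain ⟨s, rfl⟩ := ins_surj p t ht.2.1
    refine ⟨s, ?_, rfl⟩
    simp only [ins_inv, ins_Q3, ins_Q4, ins_fix, ins_self] at ht
    simp only [T, Finset.mem_filter, Finset.mem_univ, true_and]
    obtain ⟨h1, -, h2, h3, h4⟩ := ht
    exact ⟨h1, h2, h3, by omega⟩

/-! ### Openers -/

lemma card_split {n : ℕ} (s : Equiv.Perm (Fin n)) (hs : IsInvol s) :
    n = 2 * (opS s).card + (fixS s).card := by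
  have h1 : (opS s).card = (Finset.univ.filter (fun i => s i < i)).card := by
    apply Finset.card_bij (fun i _ => s i)
    · intro i hi
      rw [mem_opS] at hi
      simpa [hs i] using hi
    · intro i _ j _ h
      exact s.injective h
    · intro i hi
      refine ⟨s i, ?_, hs i⟩
      rw [mem_opS, hs i]
      simpa using hi
  have h2 : (Finset.univ : Finset (Fin n)) =
      (opS s ∪ Finset.univ.filter (fun i => s i < i)) ∪ fixS s := by
    ext i
    simp only [Finset.mem_union, mem_opS, mem_fixS, Finset.mem_filter, Finset.mem_univ, true_and,
      true_iff]
    rcases lt_trichotomy i (s i) with h | h | h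
    · simp [h]
    · exact Or.inr h.symm
    · simp [h]
  have h3 := congrArg Finset.card h2
  rw [Finset.card_union_of_disjoint, Finset.card_union_of_disjoint, Finset.card_fin] at h3
  · omega
  · rw [Finset.disjoint_left]
    intro i hi hj
    rw [mem_opS] at hi
    simp only [Finset.mem_filter, Finset.mem_univ, true_and] at hj
    exact absurd hi (not_lt.2 hj.le)
  · rw [Finset.disjoint_left]
    intro i hi hj
    rw [mem_fixS] at hj
    simp only [Finset.mem_union, mem_opS, Finset.mem_filter, Finset.mem_univ, true_and, hj,
      lt_irrefl, or_self] at hi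

lemma op_Q {n d : ℕ} (p : Fin n) (s : Equiv.Perm (Fin n)) (hs : IsInvol s) (hp : s p = p)
    (hq : Q3 p s) (hd : p.val = d) (hn : n = 2 * d + (fixS s).card) :
    ∀ i, i < s i ↔ i < p := by
  have hc : (opS s).card = d := by have := card_split s hs; omega
  have hlow : ∀ i j, j < s j → i < j → i ≠ p → i < s i := by
    intro i j hj hij hip
    by_contra hi
    have hjp : j ≠ p := by rintro rfl; rw [hp] at hj; exact lt_irrefl _ hj
    have hjp' : s j ≠ p := by
      intro h; apply hjp; rw [← hs j, h, hp]
    refine hq i j (s j) hip hjp hjp' hij hj ?_ ?_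
    · rw [hs]; exact lt_of_le_of_lt (not_lt.1 hi) hij
    · rw [hs]; exact hj
  have hsub : opS s ⊆ Finset.Iio p := by
    intro o ho
    rw [mem_opS] at ho
    rw [Finset.mem_Iio]
    by_contra hop
    have hop' : p < o := lt_of_le_of_ne (not_lt.1 hop) (by
      rintro rfl; rw [hp] at ho; exact lt_irrefl _ ho)
    have : insert o (Finset.Iio p) ⊆ opS s := by
      intro i hi
      rw [mem_opS]
      rcases Finset.mem_insert.1 hi with rfl | hi
      · exact ho
      · rw [Finset.mem_Iio] at hi
        exact hlow i o ho (hi.trans hop') hi.ne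
    have h2 := Finset.card_le_card this
    rw [Finset.card_insert_of_notMem (by simpa using hop), Fin.card_Iio] at h2
    omega
  have heq := Finset.eq_of_subset_of_card_le hsub (by rw [Fin.card_Iio]; omega)
  intro i
  rw [← mem_opS, heq, Finset.mem_Iio]

lemma op_N {n d : ℕ} (s : Equiv.Perm (Fin n)) (hs : IsInvol s)
    (hq : N3 s) (hn : n = 2 * d + (fixS s).card) :
    ∀ i, i < s i ↔ i.val < d := by
  have hc : (opS s).card = d := by have := card_split s hs; omega
  have hlow : ∀ i j, j < s j → i < j → i < s i := by
    intro i j hj hij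
    by_contra hi
    refine hq i j (s j) hij hj ?_ ?_
    · rw [hs]; exact lt_of_le_of_lt (not_lt.1 hi) hij
    · rw [hs]; exact hj
  have hcard : (Finset.univ.filter (fun i : Fin n => i.val < d)).card = d := by
    rw [Fin.card_filter_val_lt]; omega
  have hsub : opS s ⊆ Finset.univ.filter (fun i : Fin n => i.val < d) := by
    intro o ho
    rw [mem_opS] at ho
    simp only [Finset.mem_filter, Finset.mem_univ, true_and]
    by_contra hop
    have : insert o (Finset.univ.filter (fun i : Fin n => i.val < d)) ⊆ opS s := by
      intro i hi
      rw [mem_opS]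
      rcases Finset.mem_insert.1 hi with rfl | hi
      · exact ho
      · simp only [Finset.mem_filter, Finset.mem_univ, true_and] at hi
        exact hlow i o ho (by rw [Fin.lt_def]; omega)
    have h2 := Finset.card_le_card this
    rw [Finset.card_insert_of_notMem (by simpa using hop), hcard] at h2
    omega
  have heq := Finset.eq_of_subset_of_card_le hsub (by omega)
  intro i
  rw [← mem_opS, heq]; simp

/-! ### Structure around the centre -/

lemma ctr1 {n : ℕ} {p : Fin n} {s : Equiv.Perm (Fin n)} (hs : IsInvol s) (hp : s p = p)
    (ho : ∀ i, i < s i ↔ i < p) (i : Fin n) (hi : i < p) : p < s i := by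
  have h1 := (ho i).2 hi
  have h2 : ¬ s i < p := by
    rw [← ho, hs]; exact not_lt.2 h1.le
  refine lt_of_le_of_ne (not_lt.1 h2) ?_
  intro h
  have : s p = i := by rw [h, hs]
  rw [hp] at this
  exact hi.ne this.symm

lemma ctr2 {n : ℕ} {p : Fin n} {s : Equiv.Perm (Fin n)} (hs : IsInvol s)
    (ho : ∀ i, i < s i ↔ i < p) (i : Fin n) (hi : p ≤ i) (hsi : p ≤ s i) : s i = i := by
  have h1 : ¬ i < s i := by rw [ho]; exact not_lt.2 hi
  have h2 : ¬ s i < i := by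
    have := ho (s i)
    rw [hs] at this
    rw [this]; exact not_lt.2 hsi
  exact le_antisymm (not_lt.1 h1) (not_lt.1 h2)

lemma U3 {n : ℕ} {p : Fin n} {s : Equiv.Perm (Fin n)} (hs : IsInvol s) (hp : s p = p)
    (ho : ∀ i, i < s i ↔ i < p) (hq : Q3 p s) : N3 s := by
  intro i j k h1 h2 h3 h4
  have c1 := ctr1 hs hp ho
  have c2 := ctr2 hs ho
  by_cases hi : i = p
  · subst hi
    have e1 := c2 k (h1.trans h2).le (by rw [hp] at h3; exact h3.le)
    have e2 := c2 j h1.le (by rw [hp] at h3; exact (h3.trans h4).le)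
    grind
  by_cases hj : j = p
  · have := c1 i (by grind)
    grind
  by_cases hk : k = p
  · have := c1 i (by grind)
    grind
  exact hq i j k hi hj hk h1 h2 h3 h4

lemma U4' {n : ℕ} {p : Fin n} {s : Equiv.Perm (Fin n)} (hs : IsInvol s) (hp : s p = p)
    (ho : ∀ i, i < s i ↔ i < p) (hq : Q4 p s) (i j k l : Fin n)
    (h1 : i < j) (h2 : j < k) (h3 : k < l) (h4 : s i < s j) (h5 : s j < s k) (h6 : s k < s l) :
    s i = i ∧ s j = j ∧ s k = k ∧ s l = l := by
  have c1 := ctr1 hs hp ho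
  have c2 := ctr2 hs ho
  by_cases hi : i = p
  · have := c2 j (by grind) (by grind)
    have := c2 k (by grind) (by grind)
    have := c2 l (by grind) (by grind)
    grind
  exfalso
  by_cases hj : j = p
  · have := c1 i (by grind)
    grind
  by_cases hk : k = p
  · have := c1 i (by grind)
    grind
  by_cases hl : l = p
  · have := c1 i (by grind)
    grind
  exact hq i j k l hi hj hk hl h1 h2 h3 h4 h5 h6

lemma four_fix {n : ℕ} {s : Equiv.Perm (Fin n)} {i j k l : Fin n}
    (h1 : i < j) (h2 : j < k) (h3 : k < l)
    (h : s i = i ∧ s j = j ∧ s k = k ∧ s l = l) : 4 ≤ (fixS s).card := by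
  have hsub : ({i, j, k, l} : Finset (Fin n)) ⊆ fixS s := by
    intro x hx
    simp only [Finset.mem_insert, Finset.mem_singleton] at hx
    rw [mem_fixS]
    grind
  have hc : ({i, j, k, l} : Finset (Fin n)).card = 4 := by
    rw [Finset.card_insert_of_notMem, Finset.card_insert_of_notMem, Finset.card_insert_of_notMem,
      Finset.card_singleton] <;> simp only [Finset.mem_insert, Finset.mem_singleton] <;> grind
  rw [← hc]
  exact Finset.card_le_card hsub

lemma U4 {n : ℕ} {p : Fin n} {s : Equiv.Perm (Fin n)} (hs : IsInvol s) (hp : s p = p)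
    (ho : ∀ i, i < s i ↔ i < p) (hq : Q4 p s) (hf : (fixS s).card ≤ 3) : N4 s := by
  intro i j k l h1 h2 h3 h4 h5 h6
  have := four_fix h1 h2 h3 (U4' hs hp ho hq i j k l h1 h2 h3 h4 h5 h6)
  omega

open Classical in
lemma stepU {n d h : ℕ} (hn : n = 2 * d + h) (hh : h ≤ 3) (p : Fin n) (hp : p.val = d) :
    (T n h).filter (fun s => s p = p) = X p h := by
  ext s
  simp only [T, X, Finset.mem_filter, Finset.mem_univ, true_and]
  constructor
  · rintro ⟨⟨h1, h2, h3, h4⟩, h5⟩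
    refine ⟨h1, h5, ?_, ?_, h4⟩
    · intro i j k _ _ _
      exact h2 i j k
    · intro i j k l _ _ _ _
      exact h3 i j k l
  · rintro ⟨h1, h2, h3, h4, h5⟩
    have ho := op_Q p s h1 h2 h3 hp (by omega)
    exact ⟨⟨h1, U3 h1 h2 ho h3, U4 h1 h2 ho h4 (by omega), h5⟩, h2⟩

/-! ### The swap step -/

lemma sw_ne {n : ℕ} (t : Equiv.Perm (Fin n)) (q f x : Fin n) (h1 : x ≠ q) (h2 : x ≠ f) :
    (t * Equiv.swap q f) x = t x := by
  rw [Equiv.Perm.mul_apply, Equiv.swap_apply_of_ne_of_ne h1 h2]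

lemma sw_l {n : ℕ} (t : Equiv.Perm (Fin n)) (q f : Fin n) :
    (t * Equiv.swap q f) q = t f := by
  rw [Equiv.Perm.mul_apply, Equiv.swap_apply_left]

lemma sw_r {n : ℕ} (t : Equiv.Perm (Fin n)) (q f : Fin n) :
    (t * Equiv.swap q f) f = t q := by
  rw [Equiv.Perm.mul_apply, Equiv.swap_apply_right]

/-- The relation between `t` (both `q` and `f` fixed) and `s` (`q` and `f` exchanged). -/
structure SwRel {n : ℕ} (q f : Fin n) (t s : Equiv.Perm (Fin n)) : Prop where
  lt : q < f
  tq : t q = q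
  tf : t f = f
  sq : s q = f
  sf : s f = q
  eq : ∀ x, x ≠ q → x ≠ f → s x = t x

lemma SwRel.invol {n : ℕ} {q f : Fin n} {t s : Equiv.Perm (Fin n)} (r : SwRel q f t s) :
    IsInvol t ↔ IsInvol s := by
  obtain ⟨h1, h2, h3, h4, h5, h6⟩ := r
  constructor
  · intro h x
    by_cases hq : x = q
    · rw [hq, h4, h5]
    by_cases hf : x = f
    · rw [hf, h5, h4]
    rw [h6 x hq hf, h6, h]
    · intro h'; apply hq; rw [← h x, h', h2]
    · intro h'; apply hf; rw [← h x, h', h3]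
  · intro h x
    by_cases hq : x = q
    · rw [hq, h2, h2]
    by_cases hf : x = f
    · rw [hf, h3, h3]
    rw [← h6 x hq hf, ← h6, h]
    · intro h'; apply hf; rw [← h x, h', h4]
    · intro h'; apply hq; rw [← h x, h', h5]

lemma SwRel.fix {n : ℕ} {q f : Fin n} {t s : Equiv.Perm (Fin n)} (r : SwRel q f t s) :
    (fixS t).card = (fixS s).card + 2 := by
  obtain ⟨h1, h2, h3, h4, h5, h6⟩ := r
  have : fixS t = insert q (insert f (fixS s)) := by
    ext x
    simp only [Finset.mem_insert, mem_fixS]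
    grind
  rw [this, Finset.card_insert_of_notMem, Finset.card_insert_of_notMem]
  · rw [mem_fixS]; grind
  · rw [Finset.mem_insert, mem_fixS]; grind

lemma SwRel.fwd3 {n : ℕ} {q f : Fin n} {t s : Equiv.Perm (Fin n)} (r : SwRel q f t s)
    (hs : IsInvol t) (ho : ∀ i, i < t i ↔ i < q) (hq : Q3 q t)
    (hmin : ∀ x, q < x → t x = x → f ≤ x) : N3 s := by
  obtain ⟨h1, h2, h3, h4, h5, h6⟩ := r
  have c1 := ctr1 hs h2 ho
  have c2 := ctr2 hs ho
  intro i j k a1 a2 a3 a4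
  have hi := c1 i
  have hj := c1 j
  have hk := c1 k
  have hi' := c2 i
  have hj' := c2 j
  have hk' := c2 k
  have mi := hmin i
  have mj := hmin j
  have mk := hmin k
  have ei := h6 i
  have ej := h6 j
  have ek := h6 k
  have q1 := hq i j k
  have q2 := hq i f k
  have q3 := hq i j f
  clear hmin h6 c1 c2 hq ho hs
  by_cases i = q <;> by_cases i = f <;> by_cases j = q <;> by_cases j = f <;>
    by_cases k = q <;> by_cases k = f <;> grind

lemma SwRel.bwd3 {n : ℕ} {q f : Fin n} {t s : Equiv.Perm (Fin n)} (r : SwRel q f t s)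
    (hs : IsInvol t) (ho : ∀ i, i < t i ↔ i < q) (hq : N3 s)
    (hmin : ∀ x, q < x → t x = x → f ≤ x) : Q3 q t := by
  obtain ⟨h1, h2, h3, h4, h5, h6⟩ := r
  have c1 := ctr1 hs h2 ho
  have c2 := ctr2 hs ho
  intro i j k b1 b2 b3 a1 a2 a3 a4
  have hi := c1 i
  have hj := c1 j
  have hk := c1 k
  have hi' := c2 i
  have hj' := c2 j
  have hk' := c2 k
  have mi := hmin i
  have mj := hmin j
  have mk := hmin k
  have ei := h6 i
  have ej := h6 j
  have ek := h6 k
  have q1 := hq i j k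
  have q2 := hq i q k
  have q3 := hq i j q
  clear hmin h6 c1 c2 hq ho hs
  by_cases i = f <;> by_cases j = f <;> by_cases k = f <;> grind

lemma SwRel.fwd4 {n : ℕ} {q f : Fin n} {t s : Equiv.Perm (Fin n)} (r : SwRel q f t s)
    (hs : IsInvol t) (ho : ∀ i, i < t i ↔ i < q) (hq : Q4 q t) : N4 s := by
  obtain ⟨h1, h2, h3, h4, h5, h6⟩ := r
  have c1 := ctr1 hs h2 ho
  have c2 := ctr2 hs ho
  intro i j k l a1 a2 a3 b1 b2 b3
  have ei := h6 i
  have ej := h6 j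
  have ek := h6 k
  have el := h6 l
  have hi := c1 i
  have hj := c1 j
  have hk := c1 k
  have hi' := c2 i
  have hj' := c2 j
  have hk' := c2 k
  have hl' := c2 l
  have q1 := hq i j k l
  have q2 := hq f j k l
  have q3 := hq i f k l
  have q4 := hq i j f l
  have q5 := hq i j k f
  clear h6 c1 c2 hq ho hs
  by_cases i = q
  · grind
  by_cases j = q
  · grind
  by_cases k = q
  · grind
  by_cases l = q
  · grind
  by_cases i = f
  · grind
  by_cases j = f
  · grind
  by_cases k = f
  · grind
  by_cases l = f
  · grind
  grind

lemma SwRel.bwd4 {n : ℕ} {q f : Fin n} {t s : Equiv.Perm (Fin n)} (r : SwRel q f t s)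
    (hs : IsInvol t) (ho : ∀ i, i < t i ↔ i < q) (hq : N4 s)
    (hmin : ∀ x, q < x → t x = x → f ≤ x) : Q4 q t := by
  obtain ⟨h1, h2, h3, h4, h5, h6⟩ := r
  have c1 := ctr1 hs h2 ho
  have c2 := ctr2 hs ho
  intro i j k l d1 d2 d3 d4 a1 a2 a3 b1 b2 b3
  have ei := h6 i
  have ej := h6 j
  have ek := h6 k
  have el := h6 l
  have hi := c1 i
  have hj := c1 j
  have hk := c1 k
  have hi' := c2 i
  have hj' := c2 j
  have hk' := c2 k
  have hl' := c2 l
  have q1 := hq i j k l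
  have q2 := hq q j k l
  have q3 := hq i q k l
  have q4 := hq i j q l
  have q5 := hq i j k q
  have mi := hmin i
  have mj := hmin j
  have mk := hmin k
  clear hmin h6 c1 c2 hq ho hs
  by_cases i = f
  · grind
  by_cases j = f
  · grind
  by_cases k = f
  · grind
  by_cases l = f
  · grind
  grind

/-- `s` with `p` not fixed comes from a swap. -/
lemma down {n d : ℕ} {s : Equiv.Perm (Fin n)} (hs : IsInvol s) (h3 : N3 s)
    {p q : Fin n} (hp : p.val = d) (hq : q.val + 1 = d)
    (ho : ∀ i, i < s i ↔ i.val < d) (hsp : s p ≠ p) :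
    SwRel q (s q) (s * Equiv.swap q (s q)) s ∧
    (∀ i, i < (s * Equiv.swap q (s q)) i ↔ i < q) ∧
    (∀ x, q < x → (s * Equiv.swap q (s q)) x = x → s q ≤ x) := by
  have hqf : q < s q := by rw [ho]; omega
  have r : SwRel q (s q) (s * Equiv.swap q (s q)) s := by
    refine ⟨hqf, ?_, ?_, rfl, hs q, ?_⟩
    · rw [sw_l, hs]
    · rw [sw_r]
    · intro x hx hx'
      rw [sw_ne _ _ _ _ hx hx']
  have e1 := r.tq
  have e2 := r.tf
  have e3 := r.eq
  refine ⟨r, ?_, ?_⟩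
  · intro i
    by_cases hi : i = q
    · subst hi; rw [e1]
    by_cases hi' : i = s q
    · rw [hi', e2]
      constructor
      · intro h; exact absurd h (lt_irrefl _)
      · intro h; exact absurd h (not_lt.2 hqf.le)
    rw [← e3 i hi hi', ho, Fin.lt_def]
    have : i.val ≠ q.val := fun h => hi (Fin.ext h)
    omega
  · intro x hx hxf
    by_contra hlt
    have hlt := not_le.1 hlt
    rw [← e3 x hx.ne' hlt.ne] at hxf
    have hpx : p < x := by
      refine lt_of_le_of_ne (by rw [Fin.le_def]; rw [Fin.lt_def] at hx; omega) ?_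
      rintro rfl; exact hsp hxf
    have hep : s p < p := by
      refine lt_of_le_of_ne ?_ hsp
      have := ho p
      rw [← not_lt, this]; omega
    have heq : s p < q := by
      refine lt_of_le_of_ne (by rw [Fin.le_def]; rw [Fin.lt_def] at hep; omega) ?_
      intro h
      have : s q = p := by rw [← h, hs]
      rw [this] at hlt
      exact lt_asymm hlt hpx
    refine h3 (s p) q x heq hx ?_ ?_
    · rw [hs, hxf]; exact hpx
    · rw [hxf]; exact hlt

open Classical in
lemma stepD {n d h : ℕ} (hn : n = 2 * d + h) (p q : Fin n) (hp : p.val = d)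
    (hq : q.val + 1 = d) :
    ((T n h).filter (fun s => ¬ s p = p)).card = (X q (h + 2)).card := by
  apply Finset.card_bij (fun s _ => s * Equiv.swap q (s q))
  · intro s hs
    simp only [T, Finset.mem_filter, Finset.mem_univ, true_and] at hs
    obtain ⟨⟨h1, h2, h3, h4⟩, h5⟩ := hs
    obtain ⟨r, ho, hm⟩ := down h1 h2 hp hq (op_N s h1 h2 (by omega)) h5
    have hi := r.invol.2 h1
    simp only [X, Finset.mem_filter, Finset.mem_univ, true_and]
    exact ⟨hi, r.tq, r.bwd3 hi ho h2 hm, r.bwd4 hi ho h3 hm, by rw [r.fix, h4]⟩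
  · intro s hs s' hs' heq
    simp only [T, Finset.mem_filter, Finset.mem_univ, true_and] at hs hs'
    obtain ⟨⟨h1, h2, h3, h4⟩, h5⟩ := hs
    obtain ⟨r, ho, hm⟩ := down h1 h2 hp hq (op_N s h1 h2 (by omega)) h5
    obtain ⟨⟨h1', h2', h3', h4'⟩, h5'⟩ := hs'
    obtain ⟨r', ho', hm'⟩ := down h1' h2' hp hq (op_N s' h1' h2' (by omega)) h5'
    have hff : s q = s' q := by
      apply le_antisymm
      · apply hm _ r'.lt
        have := r'.tf
        rwa [← heq] at this
      · apply hm' _ r.lt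
        have := r.tf
        rwa [heq] at this
    rw [hff] at heq
    exact mul_right_cancel heq
  · intro t ht
    simp only [X, Finset.mem_filter, Finset.mem_univ, true_and] at ht
    obtain ⟨h1, h2, h3, h4, h5⟩ := ht
    have ho := op_Q q t h1 h2 h3 rfl (by omega)
    have hne : ((fixS t).erase q).Nonempty := by
      rw [← Finset.card_pos, Finset.card_erase_of_mem (by rw [mem_fixS]; exact h2)]
      omega
    set f := ((fixS t).erase q).min' hne with hf
    have hfm : f ∈ (fixS t).erase q := Finset.min'_mem _ _
    rw [Finset.mem_erase, mem_fixS] at hfm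
    have hqf : q < f := by
      have : ¬ f < q := by rw [← ho, hfm.2]; exact lt_irrefl _
      exact lt_of_le_of_ne (not_lt.1 this) hfm.1.symm
    have hm : ∀ x, q < x → t x = x → f ≤ x := by
      intro x hx hx'
      apply Finset.min'_le
      rw [Finset.mem_erase, mem_fixS]
      exact ⟨hx.ne', hx'⟩
    have sq : (t * Equiv.swap q f) q = f := by rw [sw_l, hfm.2]
    have r : SwRel q f t (t * Equiv.swap q f) :=
      ⟨hqf, h2, hfm.2, sq, by rw [sw_r, h2], fun x hx hx' => sw_ne _ _ _ _ hx hx'⟩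
    refine ⟨t * Equiv.swap q f, ?_, ?_⟩
    · simp only [T, Finset.mem_filter, Finset.mem_univ, true_and]
      refine ⟨⟨r.invol.1 h1, r.fwd3 h1 ho h3 hm, r.fwd4 h1 ho h4, by have := r.fix; omega⟩, ?_⟩
      intro hpp
      have hpq : q < p := by rw [Fin.lt_def]; omega
      have hpf : p ≠ f := by
        intro h
        rw [h, r.sf] at hpp
        exact hqf.ne hpp
      rw [r.eq p hpq.ne' hpf] at hpp
      have := lt_of_le_of_ne (hm p hpq hpp) hpf.symm
      rw [Fin.lt_def] at this hqf
      omega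
    · rw [sq]
      ext x
      simp

/-! ### Recursion and counting -/

lemma T_big {n h : ℕ} (hn : n < h) : T n h = ∅ := by
  classical
  rw [T, Finset.filter_eq_empty_iff]
  rintro s - ⟨-, -, -, h4⟩
  have := Finset.card_le_univ (fixS s)
  rw [Fintype.card_fin] at this
  omega

lemma T_four (n : ℕ) : T n 4 = ∅ := by
  classical
  rw [T, Finset.filter_eq_empty_iff]
  rintro s - ⟨-, -, h3, h4⟩
  set g := (fixS s).orderEmbOfFin h4 with hg
  have hm : ∀ i, s (g i) = g i := fun i => by
    rw [← mem_fixS]; exact Finset.orderEmbOfFin_mem _ _ _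
  refine h3 (g 0) (g 1) (g 2) (g 3) ?_ ?_ ?_ ?_ ?_ ?_ <;> (try simp only [hm]) <;>
    exact g.strictMono (by decide)

lemma rec_gen {n d h : ℕ} (hn : n + 1 = 2 * d + h) (hh : h ≤ 3) (hd : d < n + 1) :
    (T (n + 1) h).card = (X (⟨d, hd⟩ : Fin (n + 1)) h).card + (T n (h + 1)).card := by
  classical
  rw [← Finset.card_filter_add_card_filter_not (s := T (n + 1) h)
    (fun s => s (⟨d, hd⟩ : Fin (n + 1)) = ⟨d, hd⟩), stepU hn hh _ rfl]
  congr 1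
  rcases Nat.eq_zero_or_pos d with rfl | hpos
  · rw [T_big (n := n) (by omega), Finset.card_empty, Finset.card_eq_zero,
      Finset.filter_eq_empty_iff]
    intro s hs
    simp only [T, Finset.mem_filter, Finset.mem_univ, true_and] at hs
    obtain ⟨h1, h2, h3, h4⟩ := hs
    have ho := op_N (d := 0) s h1 h2 (by omega)
    have hf : (fixS s) = Finset.univ := by
      apply Finset.eq_univ_of_card
      rw [Fintype.card_fin]; omega
    have : (⟨0, hd⟩ : Fin (n + 1)) ∈ fixS s := by rw [hf]; exact Finset.mem_univ _
    rw [mem_fixS] at this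
    exact not_not.2 this
  · rw [stepD hn _ (⟨d - 1, by omega⟩ : Fin (n + 1)) rfl (by simp; omega), card_X]

lemma rec_succ {n h : ℕ} (hn : (n + h) % 2 = 0) (hh : h + 1 ≤ 3) (hle : h ≤ n) :
    (T (n + 1) (h + 1)).card = (T n h).card + (T n (h + 2)).card := by
  rw [rec_gen (d := (n - h) / 2) (by omega) hh (by omega), card_X]

lemma rec_zero {n : ℕ} (hn : n % 2 = 1) :
    (T (n + 1) 0).card = (T n 1).card := by
  rw [rec_gen (d := (n + 1) / 2) (by omega) (by omega) (by omega)]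
  have : X (⟨(n + 1) / 2, by omega⟩ : Fin (n + 1)) 0 = ∅ := by
    classical
    rw [X, Finset.filter_eq_empty_iff]
    rintro s - ⟨-, h2, -, -, h5⟩
    rw [Finset.card_eq_zero] at h5
    rw [← mem_fixS, h5] at h2
    exact absurd h2 (Finset.notMem_empty _)
  rw [this]; simp

lemma T_one : (T 1 1).card = 1 := by
  classical
  have : T 1 1 = Finset.univ := by
    rw [T, Finset.filter_eq_self]
    intro s _
    have hs : ∀ i, s i = i := fun i => Subsingleton.elim _ _
    refine ⟨fun i => by rw [hs, hs], ?_, ?_, ?_⟩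
    · intro i j k h
      exact absurd (Subsingleton.elim i j) h.ne
    · intro i j k l h
      exact absurd (Subsingleton.elim i j) h.ne
    · have : fixS s = Finset.univ := by ext i; simp only [mem_fixS, hs, Finset.mem_univ]
      rw [this]; simp
  rw [this]; simp

lemma T_fib (m : ℕ) : (T (2 * m + 1) 1).card = Nat.fib (2 * m + 1) ∧
    (T (2 * m + 1) 3).card = Nat.fib (2 * m) := by
  induction m with
  | zero => exact ⟨T_one, by rw [T_big (by omega)]; rfl⟩
  | succ m ih =>
    obtain ⟨a, b⟩ := ih
    have e0 : (T (2 * m + 2) 0).card = Nat.fib (2 * m + 1) := by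
      rw [rec_zero (n := 2 * m + 1) (by omega), a]
    have e2 : (T (2 * m + 2) 2).card = Nat.fib (2 * m + 2) := by
      rw [rec_succ (n := 2 * m + 1) (h := 1) (by omega) (by omega) (by omega), a, b,
        Nat.fib_add_two, add_comm]
    constructor
    · rw [show 2 * (m + 1) + 1 = (2 * m + 2) + 1 by ring,
        rec_succ (n := 2 * m + 2) (h := 0) (by omega) (by omega) (by omega), e0, e2,
        Nat.fib_add_two (n := 2 * m + 1)]
    · rw [show 2 * (m + 1) + 1 = (2 * m + 2) + 1 by ring]
      rcases Nat.eq_zero_or_pos m with rfl | hm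
      · rw [rec_succ (n := 2) (h := 2) (by omega) (by omega) (by omega), T_four, e2]; simp
      · rw [rec_succ (n := 2 * m + 2) (h := 2) (by omega) (by omega) (by omega), T_four, e2]
        simp [mul_add]

/-! ### Parity of the number of inversions of an involution -/

lemma inversions_parity {n : ℕ} (s : Equiv.Perm (Fin n)) (hs : IsInvol s) :
    Even (inversions s) ↔ Even (opS s).card := by
  classical
  set I := Finset.univ.filter (fun p : Fin n × Fin n => p.1 < p.2 ∧ s p.2 < s p.1) with hI
  have h1 : (I.filter (fun p => s p.1 = p.2)).card = (opS s).card := by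
    symm
    apply Finset.card_bij (fun i _ => (i, s i))
    · intro i hi
      rw [mem_opS] at hi
      simp [hI, hi, hs i]
    · intro i _ j _ h
      exact (Prod.ext_iff.1 h).1
    · rintro ⟨i, j⟩ hij
      simp only [hI, Finset.mem_filter, Finset.mem_univ, true_and] at hij
      refine ⟨i, ?_, ?_⟩
      · rw [mem_opS, hij.2]; exact hij.1.1
      · rw [hij.2]
  have h2 : Even (I.filter (fun p => ¬ s p.1 = p.2)).card := by
    have : (((I.filter (fun p => ¬ s p.1 = p.2)).card : ℕ) : ZMod 2) = 0 := by
      rw [Finset.card_eq_sum_ones, Nat.cast_sum]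
      apply Finset.sum_involution (fun p _ => (s p.2, s p.1))
      · intro a _; decide
      · rintro ⟨i, j⟩ hij _ h
        simp only [Finset.mem_filter] at hij
        exact hij.2 (Prod.ext_iff.1 h).2
      · rintro ⟨i, j⟩ hij
        simp only [hI, Finset.mem_filter, Finset.mem_univ, true_and, hs _] at hij ⊢
        refine ⟨⟨hij.1.2, hij.1.1⟩, ?_⟩
        intro h
        exact hij.2 h.symm
      · rintro ⟨i, j⟩ hij
        simp [hs _]
    rwa [ZMod.natCast_eq_zero_iff_even] at this
  have h3 : inversions s = (opS s).card + (I.filter (fun p => ¬ s p.1 = p.2)).card := by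
    rw [← h1, Finset.card_filter_add_card_filter_not]
    rfl
  rw [h3, Nat.even_add]
  simp [h2]

/-! ### Occurrences -/

lemma occ132 {n : ℕ} (s : Equiv.Perm (Fin n)) : occ p132 s = 0 ↔ N3 s := by
  rw [occ, Finset.card_eq_zero, Finset.filter_eq_empty_iff]
  constructor
  · intro h i j k h1 h2 h3 h4
    apply h (Finset.mem_univ ![i, j, k])
    constructor
    · intro a b
      fin_cases a <;> fin_cases b <;> simp <;> grind
    · intro a b
      fin_cases a <;> fin_cases b <;> simp [p132] <;> first | decide | grind
  · intro h f _ hf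
    refine h (f 0) (f 1) (f 2) (hf.1 _ _ (by decide)) (hf.1 _ _ (by decide)) ?_ ?_
    · exact (hf.2 0 2).1 (by decide)
    · exact (hf.2 2 1).1 (by decide)

def IsOcc {n : ℕ} (s : Equiv.Perm (Fin n)) (f : Fin 4 → Fin n) : Prop :=
  StrictMono f ∧ StrictMono (fun a => s (f a))

lemma occ1234 {n : ℕ} (s : Equiv.Perm (Fin n)) :
    occ (1 : Equiv.Perm (Fin 4)) s = 1 ↔ ∃ f, IsOcc s f ∧ ∀ g, IsOcc s g → g = f := by
  classical
  have key : ∀ f : Fin 4 → Fin n, ((∀ a b : Fin 4, a < b → f a < f b) ∧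
    (∀ a b : Fin 4, (1 : Equiv.Perm (Fin 4)) a < (1 : Equiv.Perm (Fin 4)) b ↔
      s (f a) < s (f b))) ↔ IsOcc s f := by
    intro f
    constructor
    · rintro ⟨h1, h2⟩
      exact ⟨fun a b h => h1 a b h, fun a b h => (h2 a b).1 h⟩
    · rintro ⟨h1, h2⟩
      exact ⟨fun a b h => h1 h, fun a b => h2.lt_iff_lt.symm⟩
  rw [occ, Finset.card_eq_one]
  simp only [key]
  constructor
  · rintro ⟨f, hf⟩
    refine ⟨f, ?_, ?_⟩
    · have : f ∈ ({f} : Finset (Fin 4 → Fin n)) := Finset.mem_singleton_self f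
      rw [← hf] at this
      simpa using this
    · intro g hg
      rw [← Finset.mem_singleton, ← hf]
      simpa using hg
  · rintro ⟨f, hf, hu⟩
    refine ⟨f, ?_⟩
    ext g
    simp only [Finset.mem_filter, Finset.mem_univ, true_and, Finset.mem_singleton]
    exact ⟨hu g, fun h => h ▸ hf⟩

lemma isOcc_of_fix {n : ℕ} (s : Equiv.Perm (Fin n)) (F : Finset (Fin n)) (hF : F ⊆ fixS s)
    (hc : F.card = 4) : IsOcc s (F.orderEmbOfFin hc) := by
  refine ⟨(F.orderEmbOfFin hc).strictMono, ?_⟩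
  have : (fun a => s (F.orderEmbOfFin hc a)) = F.orderEmbOfFin hc := by
    funext a
    exact (mem_fixS _ _).1 (hF (Finset.orderEmbOfFin_mem _ _ _))
  rw [this]
  exact (F.orderEmbOfFin hc).strictMono

/-- A unique occurrence of `1234` in an involution is the set of its fixed points. -/
lemma unique_fix {n : ℕ} {s : Equiv.Perm (Fin n)} (hs : IsInvol s) {f : Fin 4 → Fin n}
    (hf : IsOcc s f) (hu : ∀ g, IsOcc s g → g = f) :
    (∀ a, s (f a) = f a) ∧ (fixS s).card = 4 := by
  have h1 : (fun a => s (f a)) = f := by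
    apply hu
    refine ⟨hf.2, ?_⟩
    simp only [hs _]
    exact hf.1
  have h1' : ∀ a, s (f a) = f a := fun a => congrFun h1 a
  refine ⟨h1', ?_⟩
  have hge := four_fix (s := s) (hf.1 (show (0 : Fin 4) < 1 by decide))
    (hf.1 (show (1 : Fin 4) < 2 by decide)) (hf.1 (show (2 : Fin 4) < 3 by decide))
    ⟨h1' _, h1' _, h1' _, h1' _⟩
  by_contra hne
  have hm : f 0 ∈ fixS s := by rw [mem_fixS]; exact h1' 0
  have h5 : 4 ≤ ((fixS s).erase (f 0)).card := by
    rw [Finset.card_erase_of_mem hm]; omega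
  obtain ⟨F, hF, hc⟩ := Finset.exists_subset_card_eq h5
  have := hu _ (isOcc_of_fix s F (hF.trans (Finset.erase_subset _ _)) hc)
  have h0 : f 0 ∈ F := by
    rw [← this]; exact Finset.orderEmbOfFin_mem _ _ _
  exact (Finset.mem_erase.1 (hF h0)).1 rfl

lemma isOcc_vec {n : ℕ} {s : Equiv.Perm (Fin n)} {i j k l : Fin n}
    (h1 : i < j) (h2 : j < k) (h3 : k < l) (h4 : s i < s j) (h5 : s j < s k) (h6 : s k < s l) :
    IsOcc s ![i, j, k, l] := by
  constructor
  · rw [Fin.strictMono_iff_lt_succ]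
    intro a
    fin_cases a <;> simpa
  · rw [Fin.strictMono_iff_lt_succ]
    intro a
    fin_cases a <;> simpa

lemma final_iff {n d : ℕ} (hn : n = 2 * d + 4) (p : Fin n) (hp : p.val = d)
    (s : Equiv.Perm (Fin n)) :
    (IsInvol s ∧ N3 s ∧ ∃ f, IsOcc s f ∧ ∀ g, IsOcc s g → g = f) ↔
    (IsInvol s ∧ s p = p ∧ Q3 p s ∧ Q4 p s ∧ (fixS s).card = 4) := by
  constructor
  · rintro ⟨hs, h3, f, hf, hu⟩
    obtain ⟨hfix, hc⟩ := unique_fix hs hf hu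
    have ho := op_N (d := d) s hs h3 (by omega)
    have hfp : ∀ x, s x = x → p ≤ x := by
      intro x hx
      have := ho x
      rw [hx] at this
      rw [Fin.le_def]
      by_contra hlt
      exact lt_irrefl _ (this.2 (by omega))
    have hpp : s p = p := by
      by_contra hpp
      have hlt : s p < p := by
        refine lt_of_le_of_ne ?_ hpp
        have := ho p
        rw [← not_lt, this]; omega
      have m01 := hf.1 (show (0 : Fin 4) < 1 by decide)
      have m12 := hf.1 (show (1 : Fin 4) < 2 by decide)
      have hp0 : p < f 0 := by
        refine lt_of_le_of_ne (hfp _ (hfix 0)) ?_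
        intro h; exact hpp (by rw [h, hfix])
      have := hu _ (isOcc_vec (s := s) (hlt.trans hp0) m01 m12
        (by rw [hs, hfix]; exact hp0) (by rw [hfix, hfix]; exact m01)
        (by rw [hfix, hfix]; exact m12))
      have h0 : s p = f 0 := congrFun this 0
      rw [h0] at hlt
      exact lt_asymm hlt hp0
    refine ⟨hs, hpp, fun i j k _ _ _ => h3 i j k, ?_, hc⟩
    intro i j k l e1 e2 e3 e4 a1 a2 a3 b1 b2 b3
    have hv := hu _ (isOcc_vec a1 a2 a3 b1 b2 b3)
    have hff := Finset.orderEmbOfFin_unique hc (fun x => (mem_fixS s _).2 (hfix x)) hf.1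
    have hpm : p ∈ Set.range f := by
      rw [hff, Finset.range_orderEmbOfFin]
      exact (mem_fixS s p).2 hpp
    rw [← hv] at hpm
    obtain ⟨a, ha⟩ := hpm
    fin_cases a
    · exact e1 ha
    · exact e2 ha
    · exact e3 ha
    · exact e4 ha
  · rintro ⟨hs, hpp, h3, h4, hc⟩
    have ho := op_Q p s hs hpp h3 hp (by omega)
    refine ⟨hs, U3 hs hpp ho h3, (fixS s).orderEmbOfFin hc,
      isOcc_of_fix s _ (Finset.Subset.refl _) hc, ?_⟩
    intro g hg
    apply Finset.orderEmbOfFin_unique hc _ hg.1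
    obtain ⟨x0, x1, x2, x3⟩ := U4' hs hpp ho h4 (g 0) (g 1) (g 2) (g 3)
      (hg.1 (by decide)) (hg.1 (by decide)) (hg.1 (by decide))
      (hg.2 (by decide)) (hg.2 (by decide)) (hg.2 (by decide))
    intro a
    rw [mem_fixS]
    fin_cases a
    · exact x0
    · exact x1
    · exact x2
    · exact x3

/-- The count equals fib(n−2) if n is a positive multiple of 4, else 0. -/
theorem even_involutions_avoiding_132_containing_1234_once (n : ℕ) :
    cnt n = if 0 < n ∧ n % 4 = 0 then Nat.fib (n - 2) else 0 := by
  classical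
  have hsplit : ∀ s : Equiv.Perm (Fin n), ((∀ i, s (s i) = i) ∧ Even (inversions s) ∧
      occ p132 s = 0 ∧ occ (1 : Equiv.Perm (Fin 4)) s = 1) ↔
      ((0 < n ∧ n % 4 = 0) ∧ IsInvol s ∧ N3 s ∧ ∃ f, IsOcc s f ∧ ∀ g, IsOcc s g → g = f) := by
    intro s
    rw [occ132, occ1234]
    constructor
    · rintro ⟨hs, he, h3, f, hf, hu⟩
      have hs' : IsInvol s := hs
      rw [inversions_parity s hs'] at he
      have h1 := card_split s hs'
      have h2 := (unique_fix hs' hf hu).2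
      obtain ⟨r, hr⟩ := he
      exact ⟨by omega, hs', h3, f, hf, hu⟩
    · rintro ⟨hn, hs, h3, f, hf, hu⟩
      refine ⟨hs, ?_, h3, f, hf, hu⟩
      rw [inversions_parity s hs, Nat.even_iff]
      have h1 := card_split s hs
      have h2 := (unique_fix hs hf hu).2
      omega
  rw [cnt]
  simp only [hsplit]
  split_ifs with hn
  · obtain ⟨m, rfl⟩ : ∃ m, n = 2 * m + 1 + 1 := ⟨(n - 2) / 2, by omega⟩
    have hm : 1 ≤ m := by omega
    have hX : (Finset.univ.filter (fun s : Equiv.Perm (Fin (2 * m + 1 + 1)) =>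
        (0 < 2 * m + 1 + 1 ∧ (2 * m + 1 + 1) % 4 = 0) ∧ IsInvol s ∧ N3 s ∧
          ∃ f, IsOcc s f ∧ ∀ g, IsOcc s g → g = f)) =
        X (⟨m - 1, by omega⟩ : Fin (2 * m + 1 + 1)) 4 := by
      ext s
      simp only [X, Finset.mem_filter, Finset.mem_univ, true_and]
      rw [final_iff (d := m - 1) (by omega) (⟨m - 1, by omega⟩ : Fin (2 * m + 1 + 1)) rfl s]
      exact ⟨fun h => h.2, fun h => ⟨hn, h⟩⟩
    have := card_X (⟨m - 1, by omega⟩ : Fin (2 * m + 1 + 1)) 3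
    rw [(T_fib m).2] at this
    rw [show 2 * m + 1 + 1 - 2 = 2 * m by omega, ← this, ← hX]
  · rw [Finset.card_eq_zero, Finset.filter_eq_empty_iff]
    intro s _ h
    exact hn h.1
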